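/- Let X be a compact metrizable convex set and (K_n)_{n∈ℕ} a sequence of nonempty closed faces of X; let M = ⋃_n K_n and suppose M is closed. Then the closed convex hull of M is a closed face of X, and its extreme points are contained in M ∩ ext(X). -/

import Mathlib

open MeasureTheory

open Set Filter Topology in
/-- A compact convex subset of a normed space carries a continuous strictly convex function. -/
theorem IsCompact.exists_continuous_strictConvexOn {E : Type*} [NormedAddCommGroup E]
    [NormedSpace ℝ E] {X : Set E} (hX : IsCompact X) (hconv : Convex ℝ X) :
    ∃ f : E → ℝ, Continuous f ∧ StrictConvexOn ℝ X f := by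
  obtain ⟨c, hc, hXc⟩ :=
    ((hX.prod hX).image (f := fun p : E × E => p.1 - p.2) (by fun_prop)).isSeparable
  obtain ⟨d, hd⟩ := (hc.insert 0).exists_eq_range (insert_nonempty 0 c)
  choose g hg1 hgd using fun n : ℕ => exists_dual_vector'' ℝ (d n)
  have hgle (n : ℕ) (x : E) : |g n x| ≤ ‖x‖ := by
    simpa using (g n).le_of_opNorm_le (hg1 n) x
  have hterm (n : ℕ) (x : E) {R : ℝ} (hx : ‖x‖ ≤ R) :
      ‖(1 / 2 : ℝ) ^ n * g n x ^ 2‖ ≤ (1 / 2 : ℝ) ^ n * R ^ 2 := by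
    rw [norm_mul, norm_pow, norm_pow, Real.norm_eq_abs (g n x)]
    have : |g n x| ≤ R := (hgle n x).trans hx
    norm_num
    exact sq_le_sq' (by linarith [neg_abs_le (g n x)]) (by linarith [le_abs_self (g n x)])
  have hsumR (R : ℝ) : Summable fun n : ℕ => (1 / 2 : ℝ) ^ n * R ^ 2 :=
    summable_geometric_two.mul_right _
  have hsum (x : E) : Summable fun n : ℕ => (1 / 2 : ℝ) ^ n * g n x ^ 2 :=
    (hsumR ‖x‖).of_norm_bounded fun n => hterm n x le_rfl
  refine ⟨fun x => ∑' n : ℕ, (1 / 2 : ℝ) ^ n * g n x ^ 2, ?_, hconv, ?_⟩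
  · refine continuous_iff_continuousAt.2 fun x => ?_
    have hcont : ContinuousOn (fun x => ∑' n : ℕ, (1 / 2 : ℝ) ^ n * g n x ^ 2)
        (Metric.closedBall 0 (‖x‖ + 1)) :=
      continuousOn_tsum (fun n => by fun_prop) (hsumR (‖x‖ + 1))
        fun n y hy => hterm n y (by simpa using hy)
    refine hcont.continuousAt (Filter.mem_of_superset
      (Metric.isOpen_ball.mem_nhds (x := x) (by simp)) Metric.ball_subset_closedBall)
  · intro x hx y hy hxy a b ha hb hab
    have hv : 0 < ‖x - y‖ := norm_pos_iff.2 (sub_ne_zero.2 hxy)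
    obtain ⟨w, hw, hwv⟩ := Metric.mem_closure_iff.1 (hXc ⟨(x, y), ⟨hx, hy⟩, rfl⟩) (‖x - y‖ / 2)
      (by positivity)
    obtain ⟨n, rfl⟩ : w ∈ range d := hd ▸ mem_insert_of_mem 0 hw
    have hpos : 0 < g n (x - y) := by
      have h1 := hgle n (x - y - d n)
      rw [map_sub, hgd, ← dist_eq_norm] at h1
      have h2 := (abs_le.1 h1).1
      have h3 : ‖x - y‖ ≤ dist (x - y) (d n) + ‖d n‖ := by
        rw [dist_eq_norm]; exact norm_le_norm_sub_add _ _
      simp only [RCLike.ofReal_real_eq_id, id_eq] at h2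
      linarith
    have hid (k : ℕ) : (1 / 2 : ℝ) ^ k * g k (a • x + b • y) ^ 2 =
        a * ((1 / 2 : ℝ) ^ k * g k x ^ 2) + b * ((1 / 2 : ℝ) ^ k * g k y ^ 2) -
          a * b * ((1 / 2 : ℝ) ^ k * g k (x - y) ^ 2) := by
      obtain rfl : b = 1 - a := by linarith
      simp only [map_add, map_smul, map_sub, smul_eq_mul]
      ring
    simp only [smul_eq_mul]
    rw [← tsum_mul_left, ← tsum_mul_left,
      ← ((hsum x).mul_left a).tsum_add ((hsum y).mul_left b)]
    refine Summable.tsum_lt_tsum (i := n) (fun k => ?_) ?_ (hsum _)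
      (((hsum x).mul_left a).add ((hsum y).mul_left b))
    · rw [hid, sub_le_self_iff]; positivity
    · rw [hid, sub_lt_self_iff]; positivity

/-- A continuous function on a compact space is integrable for every finite measure. -/
theorem Continuous.integrable_of_compactSpace {Z V : Type*} [TopologicalSpace Z] [CompactSpace Z]
    [MeasurableSpace Z] [BorelSpace Z] [NormedAddCommGroup V] {h : Z → V} (hh : Continuous h)
    (ν : Measure Z) [IsFiniteMeasure ν] : Integrable h ν :=
  hh.integrable_of_hasCompactSupport (.of_compactSpace h)

/-- Points of the closed convex hull of a compact set are barycenters of probability measures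
on that set. -/
theorem exists_probabilityMeasure_integral_eq {Z V : Type*} [TopologicalSpace Z] [CompactSpace Z]
    [T2Space Z] [MeasurableSpace Z] [BorelSpace Z] [NormedAddCommGroup V] [NormedSpace ℝ V]
    [CompleteSpace V] {h : Z → V} (hh : Continuous h) {v : V}
    (hv : v ∈ closure (convexHull ℝ (Set.range h))) :
    ∃ ν : Measure Z, IsProbabilityMeasure ν ∧ ∫ z, h z ∂ν = v := by
  have hint (ν : Measure Z) [IsFiniteMeasure ν] : Integrable h ν :=
    hh.integrable_of_compactSpace ν
  let R : Set (ProbabilityMeasure Z × V) :=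
    {p | ∀ φ : StrongDual ℝ V, ∫ z, φ (h z) ∂(p.1 : Measure Z) = φ p.2}
  have hR : IsClosed R := by
    simp only [R, Set.ofPred_forall]
    refine isClosed_iInter fun φ => isClosed_eq ?_ (by fun_prop)
    exact (ProbabilityMeasure.continuous_integral_boundedContinuousFunction
      (BoundedContinuousFunction.mkOfCompact ⟨fun z => φ (h z), by fun_prop⟩)).comp continuous_fst
  have hmem (w : V) : w ∈ Prod.snd '' R ↔
      ∃ ν : Measure Z, IsProbabilityMeasure ν ∧ ∫ z, h z ∂ν = w := by
    constructor
    · rintro ⟨⟨ν, w⟩, hν, rfl⟩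
      refine ⟨ν, inferInstance, SeparatingDual.eq_iff_forall_dual_eq (R := ℝ) |>.2 fun φ => ?_⟩
      rw [← hν φ, φ.integral_comp_comm (hint _)]
    · rintro ⟨ν, hν, rfl⟩
      exact ⟨⟨⟨ν, hν⟩, _⟩, fun φ => φ.integral_comp_comm (hint ν), rfl⟩
  rw [← hmem]
  refine closure_minimal (convexHull_min ?_ ?_) (isClosedMap_snd_of_compactSpace _ hR) hv
  · rintro _ ⟨z, rfl⟩
    exact (hmem _).2 ⟨Measure.dirac z, inferInstance, integral_dirac _ _⟩
  · intro x hx y hy a b ha hb hab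
    obtain ⟨μ, hμ, rfl⟩ := (hmem x).1 hx
    obtain ⟨ν, hν, rfl⟩ := (hmem y).1 hy
    refine (hmem _).2 ⟨ENNReal.ofReal a • μ + ENNReal.ofReal b • ν, ⟨?_⟩, ?_⟩
    · simp [← ENNReal.ofReal_add ha hb, hab]
    · rw [integral_add_measure ((hint μ).smul_measure (by simp))
        ((hint ν).smul_measure (by simp)), integral_smul_measure, integral_smul_measure,
        ENNReal.toReal_ofReal ha, ENNReal.toReal_ofReal hb]

/-- The closed convex hull of a compact set in a Banach space is compact. -/
theorem IsCompact.isCompact_closure_convexHull {V : Type*} [NormedAddCommGroup V] [NormedSpace ℝ V]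
    [CompleteSpace V] {s : Set V} (hs : IsCompact s) : IsCompact (closure (convexHull ℝ s)) :=
  (hs.totallyBounded.convexHull.closure).isCompact_of_isClosed isClosed_closure

open Set Pointwise in
/-- Choquet's theorem relative to a closed extreme subset `M` of a compact convex set `X`: points
of the closed convex hull of `M` are barycenters of probability measures concentrated on the
extreme points of `X` lying in `M`. -/
theorem IsExtreme.exists_measure_extremePoints {E : Type*} [NormedAddCommGroup E]
    [NormedSpace ℝ E] [CompleteSpace E] [MeasurableSpace E] [BorelSpace E] {X M : Set E}
    (hX : IsCompact X) (hconv : Convex ℝ X) (hM : IsExtreme ℝ X M) (hMc : IsClosed M) {ω : E}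
    (hω : ω ∈ closure (convexHull ℝ M)) :
    ∃ μ : Measure E, IsProbabilityMeasure μ ∧ (∀ᵐ y ∂μ, y ∈ M ∩ extremePoints ℝ X) ∧
      ∫ y, y ∂μ = ω := by
  obtain ⟨f, hf, hfX⟩ := hX.exists_continuous_strictConvexOn hconv
  have hMk : IsCompact M := hX.of_isClosed_subset hMc hM.subset
  have : CompactSpace M := isCompact_iff_compactSpace.1 hMk
  let h : M → E × ℝ := fun m => (m, f m)
  have hh : Continuous h := by fun_prop
  have hval : Continuous (fun m : M => (m : E)) := continuous_subtype_val
  have hfval : Continuous (fun m : M => f m) := hf.comp hval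
  set G : Set (E × ℝ) := closure (convexHull ℝ (range h))
  have hGk : IsCompact G := (isCompact_range hh).isCompact_closure_convexHull
  have hGconv : Convex ℝ G := (convex_convexHull ℝ _).closure
  have hhG (m : M) : h m ∈ G := subset_closure (subset_convexHull ℝ _ (mem_range_self m))
  -- the maximal value over `ω` of the closed convex hull of the graph of `f`
  obtain ⟨s, hsG, hs⟩ : ∃ s, (ω, s) ∈ G ∧ ∀ s', (ω, s') ∈ G → s' ≤ s := by
    obtain ⟨ν, hν, hνω⟩ := exists_probabilityMeasure_integral_eq hval (v := ω) (by simpa using hω)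
    have h0 : ∫ m, h m ∂ν ∈ G :=
      hGconv.integral_mem isClosed_closure (.of_forall hhG) (hh.integrable_of_compactSpace ν)
    have hne : (G ∩ Prod.fst ⁻¹' {ω}).Nonempty := by
      refine ⟨_, h0, ?_⟩
      rw [mem_preimage, fst_integral (hh.integrable_of_compactSpace ν)]
      exact hνω
    obtain ⟨⟨_, s⟩, ⟨hp, rfl⟩, hmax⟩ := (hGk.inter_right
      (isClosed_singleton.preimage continuous_fst)).exists_isMaxOn hne continuous_snd.continuousOn
    exact ⟨s, hp, fun s' hs' => hmax (a := (_, s')) ⟨hs', rfl⟩⟩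
  obtain ⟨ν, hν, hνs⟩ := exists_probabilityMeasure_integral_eq hh hsG
  have hνpair : ∫ m : M, ((m : E), f m) ∂ν = (ω, s) := hνs
  rw [integral_pair (hval.integrable_of_compactSpace ν) (hfval.integrable_of_compactSpace ν),
    Prod.mk.injEq] at hνpair
  obtain ⟨hν1, hν2⟩ := hνpair
  -- the points admitting a segment on which `f` is convex with a definite gap
  let T (ε : ℝ) : Set (E × E × ℝ) := (M ×ˢ M ×ˢ Icc (0 : ℝ) 1) ∩
    {p | f ((1 - p.2.2) • p.1 + p.2.2 • p.2.1) + ε ≤ (1 - p.2.2) * f p.1 + p.2.2 * f p.2.1}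
  let A (ε : ℝ) : Set E := (fun p : E × E × ℝ => (1 - p.2.2) • p.1 + p.2.2 • p.2.1) '' T ε
  have hA (ε : ℝ) : IsClosed (A ε) := by
    refine IsCompact.isClosed (IsCompact.image ?_ (by fun_prop))
    exact (hMk.prod (hMk.prod isCompact_Icc)).inter_right
      (isClosed_le (by fun_prop) (by fun_prop))
  have hnull (ε : ℝ) (hε : 0 < ε) : ∀ᵐ m : M ∂ν, (m : E) ∉ A ε := by
    have hmeas : MeasurableSet {m : M | (m : E) ∈ A ε} :=
      (hA ε).measurableSet.preimage measurable_subtype_coe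
    by_contra hcon
    have hpos : 0 < ν.real {m : M | (m : E) ∈ A ε} := by
      rw [measureReal_def]
      refine ENNReal.toReal_pos ?_ (measure_ne_top _ _)
      simpa [ae_iff] using hcon
    let u : M → ℝ := fun m => f m + {m : M | (m : E) ∈ A ε}.indicator (fun _ => ε) m
    have hindint : Integrable ({m : M | (m : E) ∈ A ε}.indicator (fun _ => ε)) ν :=
      (integrable_const ε).indicator hmeas
    have huint : Integrable u ν := (hfval.integrable_of_compactSpace ν).add hindint
    have hu : ∫ m, u m ∂ν = s + ν.real {m : M | (m : E) ∈ A ε} * ε := by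
      rw [integral_add (hfval.integrable_of_compactSpace ν) hindint, hν2,
        integral_indicator_const _ hmeas, smul_eq_mul]
    let G' : Set (E × ℝ) := G + {0} ×ˢ Iic 0
    have hG'mem (x : E) (r : ℝ) : (x, r) ∈ G' ↔ ∃ r', (x, r') ∈ G ∧ r ≤ r' := by
      constructor
      · rintro ⟨⟨x', r'⟩, hp, ⟨z, t⟩, ⟨hz, ht⟩, hpq⟩
        simp only [mem_singleton_iff] at hz
        simp only [mem_Iic] at ht
        simp only [Prod.mk_add_mk, Prod.mk.injEq] at hpq
        obtain ⟨h1, h2⟩ := hpq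
        rw [hz, add_zero] at h1
        exact ⟨r', h1 ▸ hp, by linarith⟩
      · rintro ⟨r', hp, hr⟩
        exact ⟨(x, r'), hp, (0, r - r'), ⟨rfl, by simpa using hr⟩, by simp⟩
    have hG'c : IsClosed G' := (isClosed_singleton.prod isClosed_Iic).add_left_of_isCompact hGk
    have hG'conv : Convex ℝ G' := hGconv.add ((convex_singleton 0).prod (convex_Iic 0))
    have hmem : ∫ m, ((m : E), u m) ∂ν ∈ G' := by
      refine hG'conv.integral_mem hG'c (.of_forall fun m => (hG'mem _ _).2 ?_)
        ((hval.integrable_of_compactSpace ν).prodMk huint)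
      by_cases hm : (m : E) ∈ A ε
      · obtain ⟨⟨a, b, t⟩, ⟨⟨ha, hb, ht⟩, hp⟩, hpm⟩ := hm
        have hm' : m ∈ {m : M | (m : E) ∈ A ε} := ⟨⟨a, b, t⟩, ⟨⟨ha, hb, ht⟩, hp⟩, hpm⟩
        refine ⟨(1 - t) * f a + t * f b, ?_, ?_⟩
        · have := hGconv (hhG ⟨a, ha⟩) (hhG ⟨b, hb⟩) (sub_nonneg.2 ht.2) ht.1 (by ring)
          simpa [h, ← hpm] using this
        · simp only [u, indicator_of_mem hm']
          simp only [mem_ofPred_eq] at hp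
          rw [← hpm]
          exact hp
      · refine ⟨f m, hhG m, ?_⟩
        have hm' : m ∉ {m : M | (m : E) ∈ A ε} := hm
        simp [u, indicator_of_notMem hm']
    rw [integral_pair (hval.integrable_of_compactSpace ν) huint, hν1, hu, hG'mem] at hmem
    obtain ⟨r, hr, hle⟩ := hmem
    nlinarith [hs r hr, mul_pos hpos hε]
  have hae : ∀ᵐ m : M ∂ν, (m : E) ∈ extremePoints ℝ X := by
    have hall : ∀ᵐ m : M ∂ν, ∀ n : ℕ, (m : E) ∉ A (1 / (n + 1)) :=
      ae_all_iff.2 fun n => hnull _ Nat.one_div_pos_of_nat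
    filter_upwards [hall] with m hm
    refine ⟨hM.subset m.2, fun x hx y hy hmxy => ?_⟩
    by_contra hne
    have hxM := hM.left_mem_of_mem_openSegment hx hy m.2 hmxy
    have hyM := hM.right_mem_of_mem_openSegment hx hy m.2 hmxy
    have hxy : x ≠ y := by
      rintro rfl
      rw [openSegment_same, mem_singleton_iff] at hmxy
      exact hne hmxy.symm
    obtain ⟨a, b, ha, hb, hab, hmeq⟩ := hmxy
    have hlt := hfX.2 hx hy hxy ha hb hab
    simp only [smul_eq_mul] at hlt
    obtain ⟨n, hn⟩ := exists_nat_one_div_lt (sub_pos.2 hlt)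
    obtain rfl : a = 1 - b := by linarith
    refine hm n ⟨(x, y, b), ⟨⟨hxM, hyM, hb.le, by simp only; linarith⟩, ?_⟩, hmeq⟩
    simp only [mem_ofPred_eq]
    linarith
  have hemb : MeasurableEmbedding ((↑) : M → E) := .subtype_coe hMc.measurableSet
  refine ⟨ν.map (↑), Measure.isProbabilityMeasure_map hemb.measurable.aemeasurable, ?_, ?_⟩
  · rw [hemb.ae_map_iff]
    filter_upwards [hae] with m hm using ⟨m.2, hm⟩
  · rw [hemb.integral_map, hν1]

/-- The identity is integrable with respect to a finite measure concentrated on a compact set. -/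
theorem IsCompact.integrable_id_of_ae_mem {E : Type*} [NormedAddCommGroup E] [MeasurableSpace E]
    [BorelSpace E] {X : Set E} (hX : IsCompact X) {μ : Measure E} [IsFiniteMeasure μ]
    (hμ : ∀ᵐ y ∂μ, y ∈ X) : Integrable (fun y => y) μ := by
  obtain ⟨C, hC⟩ := hX.isBounded.exists_norm_le
  refine .of_bound (aestronglyMeasurable_iff_aemeasurable_separable.2
    ⟨aemeasurable_id', X, hX.isSeparable, hμ⟩) C ?_
  filter_upwards [hμ] with y hy using hC y hy

open Set in
/-- If an extreme point of a closed convex set is the barycenter of a measure concentrated on that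
set, then the measure is concentrated at that point. -/
theorem Convex.ae_eq_of_integral_mem_extremePoints {E α : Type*} [NormedAddCommGroup E]
    [NormedSpace ℝ E] [CompleteSpace E] [MeasurableSpace α] {C : Set E} (hC : Convex ℝ C)
    (hCc : IsClosed C) {ν : Measure α} [IsProbabilityMeasure ν] {h : α → E}
    (hint : Integrable h ν) (hh : ∀ᵐ a ∂ν, h a ∈ C)
    (hx : ∫ a, h a ∂ν ∈ extremePoints ℝ C) : ∀ᵐ a ∂ν, h a = ∫ a, h a ∂ν := by
  rcases ae_eq_const_or_exists_average_ne_compl hint with H | ⟨t, ht, h0, h0', hne⟩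
  · rw [average_eq_integral ν] at H
    exact H
  · have hseg := average_mem_openSegment_compl_self ht.nullMeasurableSet h0 h0' hint
    rw [average_eq_integral ν] at hseg
    have h1 := hC.set_average_mem hCc h0 (measure_ne_top _ _) (ae_restrict_of_ae hh)
      hint.integrableOn
    have h2 := hC.set_average_mem hCc h0' (measure_ne_top _ _) (ae_restrict_of_ae hh)
      hint.integrableOn
    obtain ⟨e1, e2⟩ := (mem_extremePoints.1 hx).2 _ h1 _ h2 hseg
    exact absurd (e1.trans e2.symm) hne

theorem closedConvexHull_of_union_of_faces_is_face
    (E : Type*) [NormedAddCommGroup E] [NormedSpace ℝ E] [CompleteSpace E]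
    [MeasurableSpace E] [BorelSpace E]
    (X : Set E) (hXc : IsCompact X) (hXconv : Convex ℝ X) (hXne : X.Nonempty)
    [TopologicalSpace.MetrizableSpace X]
    (hSimplex : ∀ ω ∈ X, ∃! μ : Measure E, IsProbabilityMeasure μ ∧
      μ (Set.extremePoints ℝ X) = 1 ∧ ω = ∫ y, y ∂μ)
    (K : ℕ → Set E) (hKne : ∀ n, (K n).Nonempty) (hKclosed : ∀ n, IsClosed (K n))
    (hKface : ∀ n, IsExtreme ℝ X (K n))
    (M : Set E) (hM : M = ⋃ n, K n) (hMclosed : IsClosed M) :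
    IsClosed (closure (convexHull ℝ M)) ∧
    IsExtreme ℝ X (closure (convexHull ℝ M)) ∧
    Set.extremePoints ℝ (closure (convexHull ℝ M)) ⊆ M ∩ Set.extremePoints ℝ X := by
  have hMX : IsExtreme ℝ X M := by
    subst hM
    refine ⟨Set.iUnion_subset fun n => (hKface n).subset, fun x hx y hy z hz hzxy => ?_⟩
    obtain ⟨n, hn⟩ := Set.mem_iUnion.1 hz
    exact Set.mem_iUnion.2 ⟨n, (hKface n).left_mem_of_mem_openSegment hx hy hn hzxy⟩
  set C := closure (convexHull ℝ M)
  have hCconv : Convex ℝ C := (convex_convexHull ℝ M).closure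
  have hCX : C ⊆ X := closure_minimal (convexHull_min hMX.subset hXconv) hXc.isClosed
  have hMC : M ⊆ C := (subset_convexHull ℝ M).trans subset_closure
  have hface : IsExtreme ℝ X C := by
    refine ⟨hCX, fun x hx y hy z hz hzxy => ?_⟩
    obtain ⟨a, b, ha, hb, hab, rfl⟩ := hzxy
    obtain ⟨μ, hμ, hμM, hμz⟩ := hMX.exists_measure_extremePoints hXc hXconv hMclosed hz
    obtain ⟨μx, ⟨hμx, hμx1, hμxx⟩, -⟩ := hSimplex x hx
    obtain ⟨μy, ⟨hμy, hμy1, hμyy⟩, -⟩ := hSimplex y hy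
    have hid {ρ : Measure E} [IsProbabilityMeasure ρ] (h1 : ρ (Set.extremePoints ℝ X) = 1) :
        Integrable (fun y => y) ρ := by
      refine hXc.integrable_id_of_ae_mem ((mem_ae_iff_prob_eq_one hXc.measurableSet).2 ?_)
      exact le_antisymm prob_le_one (h1 ▸ measure_mono extremePoints_subset)
    have heq : ENNReal.ofReal a • μx + ENNReal.ofReal b • μy = μ := by
      refine (hSimplex _ (hCX hz)).unique ⟨⟨?_⟩, ?_, ?_⟩ ⟨hμ, ?_, hμz.symm⟩
      · simp [← ENNReal.ofReal_add ha.le hb.le, hab]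
      · simp [hμx1, hμy1, ← ENNReal.ofReal_add ha.le hb.le, hab]
      · rw [integral_add_measure ((hid hμx1).smul_measure (by simp))
          ((hid hμy1).smul_measure (by simp)), integral_smul_measure, integral_smul_measure,
          ENNReal.toReal_ofReal ha.le, ENNReal.toReal_ofReal hb.le, ← hμxx, ← hμyy]
      · exact (measure_congr
          (Filter.eventuallyEq_univ.2 (hμM.mono fun _ h => h.2))).trans measure_univ
    have hxC : ∀ᵐ y ∂μx, y ∈ C := by
      have h1 : ∀ᵐ y ∂(ENNReal.ofReal a • μx + ENNReal.ofReal b • μy), y ∈ C :=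
        heq ▸ hμM.mono fun y hy => hMC hy.1
      have h2 := (ae_add_measure_iff.1 h1).1
      rwa [Measure.ae_ennreal_smul_measure_iff (by simpa using ha)] at h2
    rw [hμxx]
    exact hCconv.integral_mem isClosed_closure hxC (hid hμx1)
  refine ⟨isClosed_closure, hface, fun x hx => ⟨?_, hface.extremePoints_subset_extremePoints hx⟩⟩
  obtain ⟨μ, hμ, hμM, rfl⟩ := hMX.exists_measure_extremePoints hXc hXconv hMclosed hx.1
  have hint : Integrable (fun y => y) μ :=
    hXc.integrable_id_of_ae_mem (hμM.mono fun y hy => hMX.subset hy.1)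
  have hae := hCconv.ae_eq_of_integral_mem_extremePoints isClosed_closure hint
    (hμM.mono fun y hy => hMC hy.1) hx
  obtain ⟨y, hyM, hy⟩ := (hμM.and hae).exists
  exact hy ▸ hyM.1
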